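/- arXiv:1308.3399 — 3 statements merged into one kernel-verified Lean document; each statement's English description precedes it below -/
import Mathlib

section
/- For every complex number z = x + iy with y = Im z > 0, the Faddeeva (complex error) function admits the integral representation w(z) = (1/√π) ∫₀^∞ exp(−t²/4) · exp(izt) dt; that is, exp(−z²)·(1 + (2i/√π)·z·∫₀¹ exp(z²s²) ds) = (1/√π) ∫₀^∞ exp(−t²/4)·exp(−yt)·exp(ixt) dt. -/
open Complex Real MeasureTheory

open Filter Topology Set

lemma norm_cexp_neg_sq_div_four_add_mul_le {C : ℝ} {a : ℂ} (ha : ‖a‖ ≤ C) {t : ℝ} (ht : 0 ≤ t) :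
    ‖cexp (-(t : ℂ) ^ 2 / 4 + a * t)‖ ≤ rexp (2 * C ^ 2) * rexp (-(1 / 8) * t ^ 2) := by
  rw [Complex.norm_exp, ← Real.exp_add]
  apply Real.exp_le_exp.mpr
  have h1 : (-(t : ℂ) ^ 2 / 4 + a * t).re = -t ^ 2 / 4 + a.re * t := by
    have : (-(t : ℂ) ^ 2 / 4) = ((-t ^ 2 / 4 : ℝ) : ℂ) := by push_cast; ring
    rw [this, Complex.add_re, Complex.ofReal_re, Complex.re_mul_ofReal]
  have h2 : a.re * t ≤ C * t :=
    mul_le_mul_of_nonneg_right ((Complex.re_le_norm a).trans ha) ht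
  rw [h1]
  nlinarith [sq_nonneg (t - 4 * C)]

lemma integrableOn_cexp_neg_sq_div_four_add_mul (a : ℂ) :
    IntegrableOn (fun t : ℝ ↦ cexp (-(t : ℂ) ^ 2 / 4 + a * t)) (Ioi 0) := by
  have hg := ((integrable_exp_neg_mul_sq (b := 1 / 8) (by norm_num)).const_mul
    (rexp (2 * ‖a‖ ^ 2))).integrableOn (s := Ioi 0)
  refine Integrable.mono' hg (by fun_prop) ?_
  filter_upwards [ae_restrict_mem measurableSet_Ioi] with t ht
  exact norm_cexp_neg_sq_div_four_add_mul_le le_rfl (le_of_lt ht)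

lemma hasDerivAt_integral_cexp_neg_sq_div_four_add_mul (a : ℂ) :
    IntegrableOn (fun t : ℝ ↦ (t : ℂ) * cexp (-(t : ℂ) ^ 2 / 4 + a * t)) (Ioi 0) ∧
    HasDerivAt (fun b : ℂ ↦ ∫ t in Ioi (0 : ℝ), cexp (-(t : ℂ) ^ 2 / 4 + b * t))
      (∫ t in Ioi (0 : ℝ), (t : ℂ) * cexp (-(t : ℂ) ^ 2 / 4 + a * t)) a := by
  have hg := ((integrable_mul_exp_neg_mul_sq (b := 1 / 8) (by norm_num)).const_mul
    (rexp (2 * (‖a‖ + 1) ^ 2))).integrableOn (s := Ioi 0)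
  refine hasDerivAt_integral_of_dominated_loc_of_deriv_le
    (μ := volume.restrict (Ioi (0 : ℝ)))
    (F := fun b (t : ℝ) ↦ cexp (-(t : ℂ) ^ 2 / 4 + b * t))
    (F' := fun b (t : ℝ) ↦ (t : ℂ) * cexp (-(t : ℂ) ^ 2 / 4 + b * t))
    (Metric.ball_mem_nhds a one_pos) (Eventually.of_forall fun b ↦ by fun_prop)
    (integrableOn_cexp_neg_sq_div_four_add_mul a) (by fun_prop) ?_ hg ?_
  · filter_upwards [ae_restrict_mem measurableSet_Ioi] with t ht b hb
    have ht0 : 0 ≤ t := le_of_lt ht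
    have hb' : ‖b‖ ≤ ‖a‖ + 1 := by
      have := norm_sub_norm_le b a
      rw [mem_ball_iff_norm] at hb
      linarith
    rw [norm_mul, Complex.norm_of_nonneg ht0, mul_left_comm]
    exact mul_le_mul_of_nonneg_left (norm_cexp_neg_sq_div_four_add_mul_le hb' ht0) ht0
  · refine Eventually.of_forall fun t b _ ↦ ?_
    have h := (((hasDerivAt_id b).mul_const (t : ℂ)).const_add (-(t : ℂ) ^ 2 / 4)).cexp
    simpa [mul_comm] using h

lemma integral_mul_cexp_neg_sq_div_four_add_mul (a : ℂ) :
    ∫ t in Ioi (0 : ℝ), (t : ℂ) * cexp (-(t : ℂ) ^ 2 / 4 + a * t) =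
      2 + 2 * a * ∫ t in Ioi (0 : ℝ), cexp (-(t : ℂ) ^ 2 / 4 + a * t) := by
  have hi := integrableOn_cexp_neg_sq_div_four_add_mul a
  have hti := (hasDerivAt_integral_cexp_neg_sq_div_four_add_mul a).1
  have hderiv : ∀ t ∈ Ici (0 : ℝ), HasDerivAt (fun t : ℝ ↦ -2 * cexp (-(t : ℂ) ^ 2 / 4 + a * t))
      ((t : ℂ) * cexp (-(t : ℂ) ^ 2 / 4 + a * t)
        - 2 * a * cexp (-(t : ℂ) ^ 2 / 4 + a * t)) t := by
    intro t _
    have ho : HasDerivAt (fun t : ℝ ↦ (t : ℂ)) 1 t := Complex.ofRealCLM.hasDerivAt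
    have h := ((((ho.pow 2).neg.div_const 4).add (ho.const_mul a)).cexp).const_mul (-2)
    refine h.congr_deriv ?_
    simp
    ring
  have hlim : Tendsto (fun t : ℝ ↦ -2 * cexp (-(t : ℂ) ^ 2 / 4 + a * t)) atTop (𝓝 0) := by
    have hb : Tendsto (fun t : ℝ ↦ rexp (2 * ‖a‖ ^ 2) * rexp (-(1 / 8) * t ^ 2)) atTop (𝓝 0) := by
      have : Tendsto (fun t : ℝ ↦ -(1 / 8) * t ^ 2) atTop atBot :=
        (tendsto_pow_atTop two_ne_zero).const_mul_atTop_of_neg (by norm_num)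
      simpa using (Real.tendsto_exp_atBot.comp this).const_mul (rexp (2 * ‖a‖ ^ 2))
    have h0 : Tendsto (fun t : ℝ ↦ cexp (-(t : ℂ) ^ 2 / 4 + a * t)) atTop (𝓝 0) := by
      refine squeeze_zero_norm' ?_ hb
      filter_upwards [eventually_ge_atTop 0] with t ht
      exact norm_cexp_neg_sq_div_four_add_mul_le le_rfl ht
    simpa using h0.const_mul (-2)
  have key := integral_Ioi_of_hasDerivAt_of_tendsto' hderiv (hti.sub (hi.const_mul _)) hlim
  rw [integral_sub hti (hi.const_mul _), integral_const_mul] at key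
  simp at key
  linear_combination key

lemma integral_cexp_neg_sq_div_four_Ioi :
    ∫ t in Ioi (0 : ℝ), cexp (-(t : ℂ) ^ 2 / 4) = (√π : ℂ) := by
  have h := integral_gaussian_Ioi (1 / 4)
  have h4 : √(π / (1 / 4)) / 2 = √π := by
    rw [show π / (1 / 4) = 2 ^ 2 * π by ring, Real.sqrt_mul (by norm_num),
      Real.sqrt_sq (by norm_num)]
    ring
  rw [h4] at h
  rw [← h, ← integral_complex_ofReal]
  congr with t
  push_cast
  congr 1
  ring

lemma cexp_sq_mul_integral_cexp_neg_sq_div_four_add_mul (z : ℂ) :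
    cexp (z ^ 2) * ∫ t in Ioi (0 : ℝ), cexp (-(t : ℂ) ^ 2 / 4 + I * z * t) =
      √π + 2 * I * z * ∫ s in (0 : ℝ)..1, cexp (z ^ 2 * (s : ℂ) ^ 2) := by
  have hderiv : ∀ r ∈ uIcc (0 : ℝ) 1, HasDerivAt
      (fun r : ℝ ↦ cexp (z ^ 2 * (r : ℂ) ^ 2) *
        ∫ t in Ioi (0 : ℝ), cexp (-(t : ℂ) ^ 2 / 4 + I * z * r * t))
      (2 * I * z * cexp (z ^ 2 * (r : ℂ) ^ 2)) r := by
    intro r _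
    have ho : HasDerivAt (fun t : ℝ ↦ (t : ℂ)) 1 r := Complex.ofRealCLM.hasDerivAt
    have hG := (hasDerivAt_integral_cexp_neg_sq_div_four_add_mul (I * z * r)).2
    rw [integral_mul_cexp_neg_sq_div_four_add_mul] at hG
    have h := ((ho.pow 2).const_mul (z ^ 2)).cexp.mul
      (HasDerivAt.comp (h := fun r : ℝ ↦ I * z * r) r hG (ho.const_mul (I * z)))
    refine h.congr_deriv ?_
    simp only [Function.comp_apply, Pi.pow_apply]
    push_cast
    linear_combination (2 * z ^ 2 * r * cexp (z ^ 2 * (r : ℂ) ^ 2) *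
      ∫ t in Ioi (0 : ℝ), cexp (-(t : ℂ) ^ 2 / 4 + I * z * r * t)) * Complex.I_sq
  have key := intervalIntegral.integral_eq_sub_of_hasDerivAt hderiv
    (Continuous.intervalIntegrable (by fun_prop) _ _)
  rw [intervalIntegral.integral_const_mul] at key
  simp [integral_cexp_neg_sq_div_four_Ioi] at key
  linear_combination -key

/-- Integral representation of the Faddeeva function on the upper half-plane:
`w(z) = (1/√π) ∫₀^∞ exp(−t²/4)·exp(izt) dt` for `z = x + iy`, `y > 0`. -/
theorem faddeeva_integral_repr (x y : ℝ) (hy : 0 < y) :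
    Complex.exp (-(x + y * Complex.I) ^ 2) *
        (1 + (2 * Complex.I / (Real.sqrt π : ℂ)) * (x + y * Complex.I) *
          ∫ s in (0:ℝ)..1, Complex.exp ((x + y * Complex.I) ^ 2 * (s : ℂ) ^ 2)) =
      (1 / (Real.sqrt π : ℂ)) *
        ∫ t in Set.Ioi (0:ℝ),
          Complex.exp (-(t : ℂ) ^ 2 / 4) * Complex.exp (-(y : ℂ) * t) *
            Complex.exp (Complex.I * (x : ℂ) * t) := by
  have hint : ∫ t in Set.Ioi (0:ℝ), Complex.exp (-(t : ℂ) ^ 2 / 4) *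
      Complex.exp (-(y : ℂ) * t) * Complex.exp (Complex.I * (x : ℂ) * t) =
      ∫ t in Set.Ioi (0:ℝ), cexp (-(t : ℂ) ^ 2 / 4 + I * (x + y * I) * t) := by
    congr with t
    rw [← Complex.exp_add, ← Complex.exp_add]
    congr 1
    linear_combination (-(y : ℂ) * t) * Complex.I_sq
  rw [hint]
  have key := cexp_sq_mul_integral_cexp_neg_sq_div_four_add_mul (x + y * I)
  have hpi : (√π : ℂ) ≠ 0 := by
    exact_mod_cast (Real.sqrt_pos.mpr Real.pi_pos).ne'
  rw [Complex.exp_neg]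
  generalize (∫ t in Ioi (0 : ℝ), cexp (-(t : ℂ) ^ 2 / 4 + I * (x + y * I) * t)) = G at key ⊢
  field_simp
  linear_combination -key
end

section
/- For all real x and all real y > 0, the real part of the Faddeeva function satisfies Re w(x + iy) = (1/√π) ∫₀^∞ exp(−t²/4)·exp(−yt)·cos(xt) dt (this real part is the Voigt function K(x,y)). -/
open Complex Real MeasureTheory

lemma norm_cexp_neg_sq_div_four_add_mul_le_s1 {c : ℂ} {R t : ℝ} (hc : ‖c‖ ≤ R) (ht : 0 ≤ t) :
    ‖Complex.exp (-(t : ℂ) ^ 2 / 4 + c * t)‖ ≤ Real.exp (-t ^ 2 / 4 + R * t) := by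
  rw [Complex.norm_exp]
  apply Real.exp_le_exp.2
  have h : (-(t : ℂ) ^ 2 / 4 + c * t).re = -t ^ 2 / 4 + c.re * t := by
    have : (-(t : ℂ) ^ 2 / 4 + c * t) = ((-t ^ 2 / 4 : ℝ) : ℂ) + c * t := by push_cast; ring
    rw [this, Complex.add_re, Complex.ofReal_re, Complex.re_mul_ofReal]
  rw [h]
  have := (Complex.re_le_norm c).trans hc
  gcongr

lemma integrable_cexp_neg_sq_div_four_add_mul (c : ℂ) :
    Integrable fun t : ℝ => Complex.exp (-(t : ℂ) ^ 2 / 4 + c * t) := by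
  have := integrable_cexp_quadratic (b := 1 / 4) (by norm_num) c 0
  refine this.congr (Filter.Eventually.of_forall fun t => ?_)
  simp only
  congr 1
  ring

lemma integrable_rexp_neg_sq_div_four_add_mul (c : ℝ) :
    Integrable fun t : ℝ => Real.exp (-t ^ 2 / 4 + c * t) := by
  refine (integrable_cexp_neg_sq_div_four_add_mul c).norm.congr
    (Filter.Eventually.of_forall fun t => ?_)
  simp only
  rw [Complex.norm_exp]
  congr 1
  rw [show (-(t : ℂ) ^ 2 / 4 + c * t) = ((-t ^ 2 / 4 + c * t : ℝ) : ℂ) by push_cast; ring,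
    Complex.ofReal_re]

lemma norm_mul_cexp_neg_sq_div_four_add_mul_le {c : ℂ} {R t : ℝ} (hc : ‖c‖ ≤ R) (ht : 0 ≤ t) :
    ‖(t : ℂ) * Complex.exp (-(t : ℂ) ^ 2 / 4 + c * t)‖ ≤
      Real.exp (-t ^ 2 / 4 + (R + 1) * t) := by
  have h1 := norm_cexp_neg_sq_div_four_add_mul_le_s1 hc ht
  have h2 : t ≤ Real.exp t := by linarith [Real.add_one_le_exp t]
  rw [norm_mul, Complex.norm_real, Real.norm_of_nonneg ht]
  calc _ ≤ Real.exp t * Real.exp (-t ^ 2 / 4 + R * t) := by gcongr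
    _ = _ := by rw [← Real.exp_add]; congr 1; ring

lemma integrableOn_mul_cexp_neg_sq_div_four_add_mul (c : ℂ) :
    IntegrableOn (fun t : ℝ => (t : ℂ) * Complex.exp (-(t : ℂ) ^ 2 / 4 + c * t)) (Set.Ioi 0) := by
  refine Integrable.mono' (integrable_rexp_neg_sq_div_four_add_mul (‖c‖ + 1)).integrableOn
    (by fun_prop) ?_
  filter_upwards [ae_restrict_mem measurableSet_Ioi] with t ht
  exact norm_mul_cexp_neg_sq_div_four_add_mul_le le_rfl (le_of_lt ht)

/-- The integral `∫ exp (-t ^ 2 / 4) * exp (c * t)` over `t ∈ (0, ∞)`. -/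
noncomputable def halfGaussianLaplace (c : ℂ) : ℂ :=
  ∫ t in Set.Ioi (0 : ℝ), Complex.exp (-(t : ℂ) ^ 2 / 4 + c * t)

lemma integral_Ioi_mul_cexp_neg_sq_div_four_add_mul (c : ℂ) :
    ∫ t in Set.Ioi (0 : ℝ), (t : ℂ) * Complex.exp (-(t : ℂ) ^ 2 / 4 + c * t) =
      2 + 2 * c * halfGaussianLaplace c := by
  set f : ℝ → ℂ := fun t => Complex.exp (-(t : ℂ) ^ 2 / 4 + c * t) with hf
  have hint : IntegrableOn f (Set.Ioi 0) := (integrable_cexp_neg_sq_div_four_add_mul c).integrableOn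
  have hmul : IntegrableOn (fun t : ℝ => (t : ℂ) * f t) (Set.Ioi 0) :=
    integrableOn_mul_cexp_neg_sq_div_four_add_mul c
  have hderiv : ∀ t : ℝ, HasDerivAt f (c * f t - 1 / 2 * ((t : ℂ) * f t)) t := by
    intro t
    have h := ((((hasDerivAt_id (t : ℂ)).pow 2).neg.div_const 4).add
      ((hasDerivAt_id (t : ℂ)).const_mul c)).cexp.comp_ofReal
    refine h.congr_deriv ?_
    simp [hf]
    ring
  have hd := (hint.const_mul c).sub (hmul.const_mul (1 / 2))
  have hlim := tendsto_zero_of_hasDerivAt_of_integrableOn_Ioi (fun t _ => hderiv t) hd hint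
  have h := integral_Ioi_of_hasDerivAt_of_tendsto' (fun t _ => hderiv t) hd hlim
  rw [integral_sub (hint.const_mul c) (hmul.const_mul (1 / 2)), integral_const_mul,
    integral_const_mul] at h
  have h0 : f 0 = 1 := by simp [hf]
  rw [h0] at h
  unfold halfGaussianLaplace
  linear_combination (-2) * h

lemma hasDerivAt_halfGaussianLaplace (c : ℂ) :
    HasDerivAt halfGaussianLaplace (2 + 2 * c * halfGaussianLaplace c) c := by
  rw [← integral_Ioi_mul_cexp_neg_sq_div_four_add_mul]
  refine (hasDerivAt_integral_of_dominated_loc_of_deriv_le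
    (F := fun (c : ℂ) (t : ℝ) => Complex.exp (-(t : ℂ) ^ 2 / 4 + c * t))
    (F' := fun (c : ℂ) (t : ℝ) => (t : ℂ) * Complex.exp (-(t : ℂ) ^ 2 / 4 + c * t))
    (bound := fun t => Real.exp (-t ^ 2 / 4 + (‖c‖ + 1 + 1) * t))
    (Metric.ball_mem_nhds c one_pos) (Filter.Eventually.of_forall fun _ => by fun_prop)
    (integrable_cexp_neg_sq_div_four_add_mul c).integrableOn (by fun_prop) ?_
    (integrable_rexp_neg_sq_div_four_add_mul _).integrableOn ?_).2
  · filter_upwards [ae_restrict_mem measurableSet_Ioi] with t ht u hu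
    refine norm_mul_cexp_neg_sq_div_four_add_mul_le ?_ (le_of_lt ht)
    rw [Metric.mem_ball, dist_eq_norm] at hu
    linarith [norm_le_norm_add_norm_sub' u c]
  · refine Filter.Eventually.of_forall fun t u _ => ?_
    refine (((hasDerivAt_id u).mul_const (t : ℂ)).const_add (-(t : ℂ) ^ 2 / 4)).cexp.congr_deriv ?_
    simp [mul_comm]

lemma halfGaussianLaplace_zero : halfGaussianLaplace 0 = (√π : ℝ) := by
  have h := integral_gaussian_Ioi (1 / 4)
  have h4 : √(π / (1 / 4)) / 2 = √π := by
    rw [show π / (1 / 4) = 2 ^ 2 * π by ring, Real.sqrt_mul (by positivity),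
      Real.sqrt_sq (by norm_num)]
    ring
  rw [h4] at h
  rw [← h, halfGaussianLaplace, ← integral_complex_ofReal]
  congr 1
  ext t
  push_cast
  congr 1
  ring

/-- At `I * z`, the half-Gaussian Laplace transform is `√π` times the Faddeeva function at `z`. -/
lemma cexp_sq_mul_halfGaussianLaplace (z : ℂ) :
    Complex.exp (z ^ 2) * halfGaussianLaplace (I * z) =
      (√π : ℝ) + 2 * I * z * ∫ s in (0 : ℝ)..1, Complex.exp (z ^ 2 * (s : ℂ) ^ 2) := by
  have hderiv : ∀ s : ℝ, HasDerivAt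
      (fun s : ℝ => Complex.exp (z ^ 2 * (s : ℂ) ^ 2) * halfGaussianLaplace (I * z * s))
      (2 * I * z * Complex.exp (z ^ 2 * (s : ℂ) ^ 2)) s := by
    intro s
    have h1 := (((hasDerivAt_id (s : ℂ)).pow 2).const_mul (z ^ 2)).cexp
    have h2 := (hasDerivAt_halfGaussianLaplace (I * z * s)).comp (s : ℂ)
      (((hasDerivAt_id (s : ℂ)).const_mul (I * z)))
    refine (h1.mul h2).comp_ofReal.congr_deriv ?_
    simp
    linear_combination (2 * z ^ 2 * s * Complex.exp (z ^ 2 * (s : ℂ) ^ 2) *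
      halfGaussianLaplace (I * z * s)) * I_sq
  have h := intervalIntegral.integral_eq_sub_of_hasDerivAt (a := 0) (b := 1)
    (fun s _ => hderiv s) (Continuous.intervalIntegrable (by fun_prop) _ _)
  rw [intervalIntegral.integral_const_mul] at h
  simp [halfGaussianLaplace_zero] at h
  linear_combination -h

/-- The real part of the Faddeeva function is the Voigt function `K(x,y)`:
`Re w(x+iy) = (1/√π) ∫₀^∞ exp(−t²/4)·exp(−yt)·cos(xt) dt` for `y > 0`. -/
theorem faddeeva_re_voigt (x y : ℝ) (hy : 0 < y) :
    (Complex.exp (-(x + y * Complex.I) ^ 2) *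
        (1 + (2 * Complex.I / (Real.sqrt π : ℂ)) * (x + y * Complex.I) *
          ∫ s in (0:ℝ)..1, Complex.exp ((x + y * Complex.I) ^ 2 * (s : ℂ) ^ 2))).re =
      (1 / Real.sqrt π) *
        ∫ t in Set.Ioi (0:ℝ),
          Real.exp (-t ^ 2 / 4) * Real.exp (-y * t) * Real.cos (x * t) := by
  have key := cexp_sq_mul_halfGaussianLaplace (x + y * I)
  set z : ℂ := x + y * I with hz
  have hpi : ((√π : ℝ) : ℂ) ≠ 0 := by
    exact_mod_cast (Real.sqrt_pos.2 Real.pi_pos).ne'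
  have hw : Complex.exp (-z ^ 2) * (1 + (2 * I / ((√π : ℝ) : ℂ)) * z *
      ∫ s in (0 : ℝ)..1, Complex.exp (z ^ 2 * (s : ℂ) ^ 2)) =
      ((1 / √π : ℝ) : ℂ) * halfGaussianLaplace (I * z) := by
    have he : Complex.exp (-z ^ 2) * Complex.exp (z ^ 2) = 1 := by
      rw [← Complex.exp_add]; simp
    push_cast
    field_simp
    rw [mul_comm z I]
    linear_combination (-Complex.exp (-z ^ 2)) * key + halfGaussianLaplace (I * z) * he
  rw [hw, Complex.re_ofReal_mul]
  congr 1
  rw [halfGaussianLaplace, ← RCLike.re_eq_complex_re,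
    ← integral_re (integrable_cexp_neg_sq_div_four_add_mul _).integrableOn]
  congr 1
  ext t
  have harg : -(t : ℂ) ^ 2 / 4 + I * z * t =
      ((-t ^ 2 / 4 + -y * t : ℝ) : ℂ) + ((x * t : ℝ) : ℂ) * I := by
    rw [hz]
    push_cast
    linear_combination (y * t : ℂ) * I_sq
  rw [RCLike.re_eq_complex_re, harg, Complex.exp_add, ← Complex.ofReal_exp, Complex.re_ofReal_mul,
    Complex.exp_ofReal_mul_I_re, Real.exp_add]
end

section
/- For all real x and all real y > 0, the imaginary part of the Faddeeva function satisfies Im w(x + iy) = (1/√π) ∫₀^∞ exp(−t²/4)·exp(−yt)·sin(xt) dt. -/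
open Complex Real MeasureTheory

/-- The integrand of the one-sided Laplace transform of the Gaussian `exp (-t ^ 2 / 4)`, evaluated at `-w`. -/
noncomputable def gaussianLaplaceKernel (w : ℂ) (t : ℝ) : ℂ :=
  Complex.exp (-(t : ℂ) ^ 2 / 4 + w * t)

/-- The one-sided Laplace transform of `exp (-t ^ 2 / 4)`, evaluated at `-w`. -/
noncomputable def gaussianLaplace (w : ℂ) : ℂ :=
  ∫ t in Set.Ioi (0 : ℝ), gaussianLaplaceKernel w t

lemma continuous_gaussianLaplaceKernel (w : ℂ) : Continuous (gaussianLaplaceKernel w) := by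
  unfold gaussianLaplaceKernel
  fun_prop

lemma integrable_gaussianLaplaceKernel (w : ℂ) : Integrable (gaussianLaplaceKernel w) := by
  have h := integrable_cexp_quadratic' (b := -(1 / 4)) (by norm_num) w 0
  refine h.congr (Filter.Eventually.of_forall fun t => ?_)
  simp only [gaussianLaplaceKernel]
  congr 1
  ring

lemma norm_gaussianLaplaceKernel (w : ℂ) (t : ℝ) :
    ‖gaussianLaplaceKernel w t‖ = Real.exp (-t ^ 2 / 4 + w.re * t) := by
  have h : -(t : ℂ) ^ 2 / 4 = ((-t ^ 2 / 4 : ℝ) : ℂ) := by push_cast; ring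
  rw [gaussianLaplaceKernel, Complex.norm_exp, h, Complex.add_re, Complex.ofReal_re,
    Complex.re_mul_ofReal]

lemma tendsto_gaussianLaplaceKernel_atTop (w : ℂ) :
    Filter.Tendsto (gaussianLaplaceKernel w) Filter.atTop (nhds 0) := by
  rw [tendsto_zero_iff_norm_tendsto_zero]
  simp_rw [norm_gaussianLaplaceKernel]
  refine Real.tendsto_exp_atBot.comp ?_
  have h : Filter.Tendsto (fun t : ℝ => t * (w.re + -(t / 4))) Filter.atTop Filter.atBot := by
    refine Filter.tendsto_id.atTop_mul_atBot₀ (Filter.tendsto_atBot_add_const_left _ _ ?_)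
    exact Filter.tendsto_neg_atTop_atBot.comp (Filter.tendsto_id.atTop_div_const (by norm_num))
  refine h.congr fun t => ?_
  ring

lemma hasDerivAt_gaussianLaplace_integral (w : ℂ) :
    Integrable (fun t : ℝ => (t : ℂ) * gaussianLaplaceKernel w t)
        (volume.restrict (Set.Ioi 0)) ∧
      HasDerivAt gaussianLaplace
        (∫ t in Set.Ioi (0 : ℝ), (t : ℂ) * gaussianLaplaceKernel w t) w := by
  refine hasDerivAt_integral_of_dominated_loc_of_deriv_le
    (μ := volume.restrict (Set.Ioi 0)) (F := gaussianLaplaceKernel)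
    (F' := fun w (t : ℝ) => (t : ℂ) * gaussianLaplaceKernel w t)
    (bound := fun t => ‖gaussianLaplaceKernel (w + 2) t‖)
    (Metric.ball_mem_nhds w one_pos)
    (Filter.Eventually.of_forall fun v =>
      (continuous_gaussianLaplaceKernel v).aestronglyMeasurable)
    (integrable_gaussianLaplaceKernel w).integrableOn
    (Complex.continuous_ofReal.mul (continuous_gaussianLaplaceKernel w)).aestronglyMeasurable
    ?_ (integrable_gaussianLaplaceKernel (w + 2)).norm.integrableOn ?_
  · filter_upwards [ae_restrict_mem measurableSet_Ioi] with t ht v hv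
    have ht : 0 < t := ht
    have hre : v.re ≤ w.re + 1 := by
      have h1 := Complex.re_le_norm (v - w)
      have h2 : ‖v - w‖ < 1 := by simpa [dist_eq_norm] using hv
      rw [Complex.sub_re] at h1
      linarith
    rw [norm_mul, norm_gaussianLaplaceKernel, norm_gaussianLaplaceKernel, Complex.norm_real,
      Real.norm_of_nonneg ht.le]
    calc t * Real.exp (-t ^ 2 / 4 + v.re * t)
        ≤ Real.exp t * Real.exp (-t ^ 2 / 4 + (w.re + 1) * t) := by
          gcongr
          linarith [Real.add_one_le_exp t]
      _ = Real.exp (-t ^ 2 / 4 + (w + 2).re * t) := by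
          rw [← Real.exp_add, Complex.add_re, Complex.re_ofNat]
          congr 1
          ring
  · refine Filter.Eventually.of_forall fun t v _ => ?_
    have h : HasDerivAt (fun v : ℂ => -(t : ℂ) ^ 2 / 4 + v * t) (t : ℂ) v := by
      simpa using ((hasDerivAt_id v).mul_const (t : ℂ)).const_add (-(t : ℂ) ^ 2 / 4)
    simpa [gaussianLaplaceKernel, mul_comm] using h.cexp

lemma hasDerivAt_gaussianLaplace (w : ℂ) :
    HasDerivAt gaussianLaplace (2 + 2 * w * gaussianLaplace w) w := by
  obtain ⟨hint, hderiv⟩ := hasDerivAt_gaussianLaplace_integral w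
  have hK := (integrable_gaussianLaplaceKernel w).integrableOn (s := Set.Ioi 0)
  have hpt (t : ℝ) : HasDerivAt (gaussianLaplaceKernel w)
      (w * gaussianLaplaceKernel w t - 1 / 2 * ((t : ℂ) * gaussianLaplaceKernel w t)) t := by
    have h : HasDerivAt (fun z : ℂ => -z ^ 2 / 4 + w * z) (-(2 * (t : ℂ)) / 4 + w) (t : ℂ) := by
      simpa using (((hasDerivAt_id (t : ℂ)).pow 2).neg.div_const 4).fun_add
        ((hasDerivAt_id (t : ℂ)).const_mul w)
    refine h.cexp.comp_ofReal.congr_deriv ?_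
    simp only [gaussianLaplaceKernel]
    ring
  have hftc := integral_Ioi_of_hasDerivAt_of_tendsto' (a := 0) (fun t _ => hpt t)
    ((hK.const_mul w).sub (hint.const_mul (1 / 2))) (tendsto_gaussianLaplaceKernel_atTop w)
  rw [integral_sub (hK.const_mul w) (hint.const_mul (1 / 2)), integral_const_mul,
    integral_const_mul] at hftc
  have h0 : gaussianLaplaceKernel w 0 = 1 := by simp [gaussianLaplaceKernel]
  rw [h0] at hftc
  refine hderiv.congr_deriv ?_
  rw [gaussianLaplace]
  linear_combination (-2) * hftc

lemma gaussianLaplace_zero : gaussianLaplace 0 = (Real.sqrt π : ℂ) := by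
  have h := integral_gaussian_Ioi (1 / 4)
  have h4 : Real.sqrt (π / (1 / 4)) = 2 * Real.sqrt π := by
    rw [show π / (1 / 4) = 2 ^ 2 * π by ring, Real.sqrt_mul (by positivity),
      Real.sqrt_sq (by norm_num)]
  rw [h4, mul_div_cancel_left₀ _ two_ne_zero] at h
  rw [← h, ← integral_complex_ofReal, gaussianLaplace]
  congr 1
  ext t
  rw [gaussianLaplaceKernel]
  push_cast
  congr 1
  ring

lemma gaussianLaplace_I_mul (z : ℂ) :
    gaussianLaplace (I * z) = Complex.exp (-z ^ 2) *
      (Real.sqrt π + 2 * I * z * ∫ s in (0 : ℝ)..1, Complex.exp (z ^ 2 * (s : ℂ) ^ 2)) := by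
  have hderiv (s : ℝ) : HasDerivAt
      (fun s : ℝ => Complex.exp (z ^ 2 * (s : ℂ) ^ 2) * gaussianLaplace (I * z * s))
      (2 * I * z * Complex.exp (z ^ 2 * (s : ℂ) ^ 2)) s := by
    have h1 : HasDerivAt (fun u : ℂ => z ^ 2 * u ^ 2) (z ^ 2 * (2 * (s : ℂ))) (s : ℂ) := by
      simpa using ((hasDerivAt_id (s : ℂ)).pow 2).const_mul (z ^ 2)
    have h2 : HasDerivAt (fun u : ℂ => I * z * u) (I * z) (s : ℂ) := by
      simpa using (hasDerivAt_id (s : ℂ)).const_mul (I * z)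
    have h3 := (hasDerivAt_gaussianLaplace (I * z * s)).comp (s : ℂ) h2
    refine (h1.cexp.mul h3).comp_ofReal.congr_deriv ?_
    simp only [Function.comp_apply]
    linear_combination (2 * Complex.exp (z ^ 2 * (s : ℂ) ^ 2) * z ^ 2 * s *
      gaussianLaplace (I * z * s)) * I_sq
  have hftc := intervalIntegral.integral_eq_sub_of_hasDerivAt (a := 0) (b := 1)
    (fun s _ => hderiv s) (Continuous.intervalIntegrable (by fun_prop) _ _)
  rw [intervalIntegral.integral_const_mul] at hftc
  simp only [ofReal_one, ofReal_zero, mul_one, one_pow, mul_zero, ne_eq, OfNat.ofNat_ne_zero,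
    not_false_eq_true, zero_pow, Complex.exp_zero, one_mul, gaussianLaplace_zero] at hftc
  rw [hftc, add_sub_cancel, ← mul_assoc, ← Complex.exp_add, neg_add_cancel, Complex.exp_zero,
    one_mul]

lemma gaussianLaplaceKernel_im (x y t : ℝ) :
    (gaussianLaplaceKernel (I * (x + y * I)) t).im =
      Real.exp (-t ^ 2 / 4) * Real.exp (-y * t) * Real.sin (x * t) := by
  have h : -(t : ℂ) ^ 2 / 4 + I * (x + y * I) * t =
      ((-t ^ 2 / 4 + -y * t : ℝ) : ℂ) + ((x * t : ℝ) : ℂ) * I := by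
    push_cast
    linear_combination (y * t : ℂ) * I_sq
  rw [gaussianLaplaceKernel, h, Complex.exp_im]
  simp only [add_re, add_im, ofReal_re, ofReal_im, re_ofReal_mul, im_ofReal_mul, I_re, I_im,
    mul_zero, mul_one, add_zero, zero_add, Real.exp_add]

/-- The imaginary part of the Faddeeva function:
`Im w(x+iy) = (1/√π) ∫₀^∞ exp(−t²/4)·exp(−yt)·sin(xt) dt` for `y > 0`. -/
theorem faddeeva_im (x y : ℝ) (hy : 0 < y) :
    (Complex.exp (-(x + y * Complex.I) ^ 2) *
        (1 + (2 * Complex.I / (Real.sqrt π : ℂ)) * (x + y * Complex.I) *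
          ∫ s in (0:ℝ)..1, Complex.exp ((x + y * Complex.I) ^ 2 * (s : ℂ) ^ 2))).im =
      (1 / Real.sqrt π) *
        ∫ t in Set.Ioi (0:ℝ),
          Real.exp (-t ^ 2 / 4) * Real.exp (-y * t) * Real.sin (x * t) := by
  have hπ : (Real.sqrt π : ℂ) ≠ 0 := by
    exact_mod_cast (Real.sqrt_pos.mpr Real.pi_pos).ne'
  have him : ∫ t in Set.Ioi (0 : ℝ), (gaussianLaplaceKernel (I * (x + y * I)) t).im =
      (gaussianLaplace (I * (x + y * I))).im :=
    integral_im (integrable_gaussianLaplaceKernel _).integrableOn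
  simp_rw [← gaussianLaplaceKernel_im]
  rw [him, ← Complex.im_ofReal_mul, gaussianLaplace_I_mul]
  congr 1
  push_cast
  field_simp
end
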